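/- Let Ξ be a real Hilbert space and S₁, …, S_m nonempty closed convex subsets of Ξ, at least one of which is bounded. Let w₁, …, w_m > 0 with Σᵢ wᵢ = 1, let P_i denote the projection onto S_i, set Φ(a) := (1/2)·Σᵢ wᵢ·dist(a, S_i)² and G := {a ∈ Ξ : Φ(a) ≤ Φ(b) for all b ∈ Ξ}. Let 0 < λ ≤ 2 and let (αₙ)ₙ ⊆ [0, 1) satisfy lim αₙ = 1, Σₙ (1 − αₙ) = +∞, and lim (α_{n+1} − αₙ)·(1 − α_{n+1})^{−2} = 0. Then for any a₀ ∈ Ξ, the sequence defined by a_{n+1} = (1 − αₙ)·a₀ + αₙ·((1 − λ)·aₙ + λ·Σᵢ wᵢ·P_i(aₙ)) converges strongly (in norm) to the projection of a₀ onto G. -/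

import Mathlib

open Filter

/-- `P` is the metric (nearest-point) projection onto the set `C`. -/
def IsProjOn {H : Type*} [NormedAddCommGroup H] (P : H → H) (C : Set H) : Prop :=
  ∀ x : H, P x ∈ C ∧ ∀ y ∈ C, ‖x - P x‖ ≤ ‖x - y‖

/-- The proximity function `Φ(a) = (1/2) Σᵢ wᵢ dist(a, Sᵢ)²`. -/
noncomputable def prox {Ξ : Type*} [NormedAddCommGroup Ξ] {m : ℕ}
    (w : Fin m → ℝ) (S : Fin m → Set Ξ) (a : Ξ) : ℝ :=
  (1 / 2) * ∑ i, w i * Metric.infDist a (S i) ^ 2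

open Topology
open scoped RealInnerProductSpace

lemma aux_xu (s γ ε : ℕ → ℝ) (hs : ∀ n, 0 ≤ s n) (hγ0 : ∀ n, 0 ≤ γ n) (hγ1 : ∀ n, γ n ≤ 1)
    (hsum : Tendsto (fun N : ℕ => ∑ n ∈ Finset.range N, γ n) atTop atTop)
    (hε : Tendsto ε atTop (𝓝 0))
    (h : ∀ n, s (n + 1) ≤ (1 - γ n) * s n + γ n * ε n) : Tendsto s atTop (𝓝 0) := by
  rw [Metric.tendsto_atTop]
  intro d hd
  have hd2 : 0 < d / 2 := by linarith
  obtain ⟨N, hN⟩ := eventually_atTop.1 (hε.eventually_lt_const hd2)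
  set M := |s N - d / 2| with hM
  have key : ∀ k, s (N + k) - d / 2 ≤
      M * Real.exp (-(∑ n ∈ Finset.range (N + k), γ n - ∑ n ∈ Finset.range N, γ n)) := by
    intro k
    induction k with
    | zero => simpa [hM] using le_abs_self (s N - d / 2)
    | succ k ih =>
      have h1 := h (N + k)
      have h2 := (hN (N + k) (by omega)).le
      have h3 : s (N + k + 1) - d / 2 ≤ (1 - γ (N + k)) * (s (N + k) - d / 2) := by
        nlinarith [mul_le_mul_of_nonneg_left h2 (hγ0 (N + k))]
      rw [← add_assoc, Finset.sum_range_succ]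
      refine h3.trans ?_
      have h4 : 1 - γ (N + k) ≤ Real.exp (-γ (N + k)) := by
        have := Real.add_one_le_exp (-γ (N + k)); linarith
      have h5 : 0 ≤ 1 - γ (N + k) := by linarith [hγ1 (N + k)]
      calc _ ≤ (1 - γ (N + k)) * (M * Real.exp (-(∑ n ∈ Finset.range (N + k), γ n - ∑ n ∈ Finset.range N, γ n))) :=
            mul_le_mul_of_nonneg_left ih h5
        _ ≤ Real.exp (-γ (N + k)) * (M * Real.exp (-(∑ n ∈ Finset.range (N + k), γ n - ∑ n ∈ Finset.range N, γ n))) := by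
            gcongr
        _ = _ := by
            rw [mul_left_comm, ← Real.exp_add]; congr 2; ring
  have hlim : Tendsto (fun K => M * Real.exp (-(∑ n ∈ Finset.range K, γ n - ∑ n ∈ Finset.range N, γ n)))
      atTop (𝓝 (M * 0)) := by
    apply Tendsto.const_mul
    apply Real.tendsto_exp_neg_atTop_nhds_zero.comp
    exact tendsto_atTop_add_const_right _ (-∑ n ∈ Finset.range N, γ n) hsum
  rw [mul_zero] at hlim
  obtain ⟨N', hN'⟩ := eventually_atTop.1 (hlim.eventually_lt_const hd2)
  refine ⟨max N N', fun n hn => ?_⟩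
  have h1 := hN' n (le_trans (le_max_right _ _) hn)
  have h2 := key (n - N)
  rw [Nat.add_sub_cancel' (le_trans (le_max_left _ _) hn)] at h2
  rw [Real.dist_eq, sub_zero, abs_of_nonneg (hs n)]
  linarith

section
variable {E : Type*} [NormedAddCommGroup E] [InnerProductSpace ℝ E]

lemma aux_mono (T : E → E) (hT : ∀ x y, ‖T x - T y‖ ≤ ‖x - y‖) (x y : E) :
    0 ≤ ⟪(x - T x) - (y - T y), x - y⟫ := by
  have h1 : (x - T x) - (y - T y) = (x - y) - (T x - T y) := by abel
  rw [h1, inner_sub_left, real_inner_self_eq_norm_sq]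
  have h2 := real_inner_le_norm (T x - T y) (x - y)
  nlinarith [hT x y, norm_nonneg (x - y)]

lemma aux_path (T : E → E) (hT : ∀ x y, ‖T x - T y‖ ≤ ‖x - y‖) (a0 x y : E) (s t : ℝ)
    (hs0 : 0 ≤ s) (hst : s < t) (ht : t < 1)
    (hx : (1 - s) • (a0 - x) = s • (x - T x)) (hy : (1 - t) • (a0 - y) = t • (y - T y)) :
    ‖y - x‖ ^ 2 ≤ ‖a0 - y‖ ^ 2 - ‖a0 - x‖ ^ 2 := by
  have hm := aux_mono T hT y x
  have h1 : (s * (1 - t)) • (a0 - y) - (t * (1 - s)) • (a0 - x)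
      = (s * t) • ((y - T y) - (x - T x)) := by
    rw [mul_smul, hy, mul_smul, hx, smul_smul, smul_smul, mul_comm t s, ← smul_sub]
  have h2 : 0 ≤ ⟪(s * (1 - t)) • (a0 - y) - (t * (1 - s)) • (a0 - x), y - x⟫ := by
    rw [h1, real_inner_smul_left]
    exact mul_nonneg (mul_nonneg hs0 (by linarith)) hm
  set u := a0 - x with hu
  set d := y - x with hd
  have h3 : a0 - y = u - d := by simp [hu, hd]
  rw [h3] at h2 ⊢
  rw [norm_sub_sq_real u d]
  rw [inner_sub_left, real_inner_smul_left, real_inner_smul_left, inner_sub_left,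
    real_inner_self_eq_norm_sq] at h2
  have h4 : 0 ≤ s * (1 - t) * ‖d‖ ^ 2 := by
    have : 0 ≤ 1 - t := by linarith
    positivity
  have h5 : ⟪u, d⟫ ≤ 0 := by
    by_contra hc
    push Not at hc
    nlinarith [mul_pos (sub_pos.2 hst) hc]
  linarith

lemma aux_halpern [CompleteSpace E] (T : E → E) (hT : ∀ x y, ‖T x - T y‖ ≤ ‖x - y‖) (a0 : E)
    (B : ℝ) (hB : ∀ t : ℝ, 0 ≤ t → t < 1 → ∀ x, (1 - t) • (a0 - x) = t • (x - T x) →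
      ‖a0 - x‖ ≤ B)
    (α : ℕ → ℝ) (hα : ∀ n, α n ∈ Set.Ico (0 : ℝ) 1)
    (hα1 : Tendsto α atTop (nhds 1))
    (hαsum : Tendsto (fun N : ℕ => ∑ n ∈ Finset.range N, (1 - α n)) atTop atTop)
    (hαreg : Tendsto (fun n : ℕ => (α (n + 1) - α n) / (1 - α (n + 1)) ^ 2) atTop (nhds 0))
    (a : ℕ → E)
    (ha : ∀ n : ℕ, a (n + 1) = (1 - α n) • a0 + α n • T (a n)) :
    ∃ g : E, T g = g ∧ (∀ u, T u = u → ‖a0 - g‖ ≤ ‖a0 - u‖) ∧ Tendsto a atTop (𝓝 g) := by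
  -- the path
  have hex : ∀ t : ℝ, ∃ x : E, t ∈ Set.Ico (0 : ℝ) 1 → x = (1 - t) • a0 + t • T x := by
    intro t
    by_cases ht : t ∈ Set.Ico (0 : ℝ) 1
    · have hc : ContractingWith ⟨t, ht.1⟩ (fun x => (1 - t) • a0 + t • T x) := by
        refine ⟨by exact_mod_cast ht.2, LipschitzWith.of_dist_le_mul fun x y => ?_⟩
        rw [dist_eq_norm, dist_eq_norm, add_sub_add_left_eq_sub, ← smul_sub, norm_smul,
          Real.norm_of_nonneg ht.1]
        exact mul_le_mul_of_nonneg_left (hT x y) ht.1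
      have : Nonempty E := ⟨a0⟩
      exact ⟨hc.fixedPoint, fun _ => hc.fixedPoint_isFixedPt.symm⟩
    · exact ⟨0, fun h => absurd h ht⟩
  choose Z hZ using hex
  set z : ℕ → E := fun n => Z (α n) with hz
  have hzf : ∀ n, z n = (1 - α n) • a0 + α n • T (z n) := fun n => hZ _ (hα n)
  have hzA : ∀ n, (1 - α n) • (a0 - z n) = α n • (z n - T (z n)) := by
    intro n
    have h := hzf n
    have : (1 - α n) • (a0 - z n) - α n • (z n - T (z n))
      = ((1 - α n) • a0 + α n • T (z n)) - z n := by module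
    rw [← sub_eq_zero, this, ← h, sub_self]
  have hzB : ∀ n, ‖a0 - z n‖ ≤ B := fun n => hB _ (hα n).1 (hα n).2 _ (hzA n)
  have hB0 : 0 ≤ B := (norm_nonneg _).trans (hzB 0)
  have hmono : ∀ n k, α n ≤ α k → ‖z k - z n‖ ^ 2 ≤ ‖a0 - z k‖ ^ 2 - ‖a0 - z n‖ ^ 2 := by
    intro n k h
    rcases h.eq_or_lt with h | h
    · simp [hz, h]
    · exact aux_path T hT a0 _ _ _ _ (hα n).1 h (hα k).2 (hzA n) (hzA k)
  have hcau : CauchySeq z := by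
    rw [Metric.cauchySeq_iff]
    intro e he
    have hbdd : BddAbove (Set.range fun n => ‖a0 - z n‖ ^ 2) := by
      refine ⟨B ^ 2, ?_⟩
      rintro _ ⟨n, rfl⟩
      exact pow_le_pow_left₀ (norm_nonneg _) (hzB n) 2
    set L := ⨆ n, ‖a0 - z n‖ ^ 2 with hL
    obtain ⟨N, hN⟩ := exists_lt_of_lt_ciSup (show L - e ^ 2 < L by nlinarith)
    obtain ⟨N', hN'⟩ := eventually_atTop.1 (hα1.eventually_const_lt (hα N).2)
    have hlow : ∀ n ≥ N', L - e ^ 2 < ‖a0 - z n‖ ^ 2 := by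
      intro n hn
      have := hmono N n (hN' n hn).le
      nlinarith [sq_nonneg ‖z n - z N‖]
    have hup : ∀ n, ‖a0 - z n‖ ^ 2 ≤ L := fun n => le_ciSup hbdd n
    refine ⟨N', fun n hn k hk => ?_⟩
    rw [dist_eq_norm]
    refine lt_of_pow_lt_pow_left₀ 2 he.le ?_
    rcases le_total (α n) (α k) with h | h
    · rw [norm_sub_rev]
      linarith [hmono n k h, hlow n hn, hup k]
    · linarith [hmono k n h, hlow k hk, hup n]
  obtain ⟨g, hg⟩ := cauchySeq_tendsto_of_complete hcau
  have hTc : Continuous T := by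
    have : LipschitzWith 1 T := LipschitzWith.of_dist_le_mul fun x y => by
      rw [dist_eq_norm, dist_eq_norm]; simpa using hT x y
    exact this.continuous
  have hTz : Tendsto (fun n => T (z n)) atTop (𝓝 (T g)) := (hTc.tendsto g).comp hg
  refine ⟨g, ?_, ?_, ?_⟩
  · have h1 : Tendsto (fun n => (1 - α n) • a0 + α n • T (z n)) atTop
        (𝓝 ((1 - (1 : ℝ)) • a0 + (1 : ℝ) • T g)) :=
      ((tendsto_const_nhds.sub hα1).smul_const a0).add (hα1.smul hTz)
    have h2 : (fun n => (1 - α n) • a0 + α n • T (z n)) = z := funext fun n => (hzf n).symm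
    rw [h2] at h1
    simpa using tendsto_nhds_unique h1 hg
  · intro u hu
    refine le_of_tendsto (tendsto_const_nhds.sub hg).norm (Eventually.of_forall fun n => ?_)
    have hm := aux_mono T hT (z n) u
    rw [hu, sub_self, sub_zero] at hm
    have h1 : 0 ≤ ⟪(1 - α n) • (a0 - z n), z n - u⟫ := by
      rw [hzA, real_inner_smul_left]
      exact mul_nonneg (hα n).1 hm
    rw [real_inner_smul_left] at h1
    have h2 : 0 ≤ ⟪a0 - z n, z n - u⟫ := nonneg_of_mul_nonneg_right h1 (by linarith [(hα n).2])
    have h3 : z n - u = (a0 - u) - (a0 - z n) := by abel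
    rw [h3, inner_sub_right, real_inner_self_eq_norm_sq] at h2
    have h4 := real_inner_le_norm (a0 - z n) (a0 - u)
    by_contra hc
    push Not at hc
    nlinarith [norm_nonneg (a0 - u), norm_nonneg (a0 - z n)]
  · -- compare
    have hTB : ∃ C : ℝ, 0 ≤ C ∧ ∀ n, ‖T (z n) - a0‖ ≤ C := by
      refine ⟨B + ‖T a0 - a0‖, by positivity, fun n => ?_⟩
      have h1 := norm_sub_le_norm_sub_add_norm_sub (T (z n)) (T a0) a0
      have h2 := hT (z n) a0
      rw [norm_sub_rev (z n)] at h2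
      linarith [hzB n]
    obtain ⟨C, hC0, hC⟩ := hTB
    have hstep : ∀ n, (1 - α (n + 1)) * ‖z (n + 1) - z n‖ ≤ |α (n + 1) - α n| * C := by
      intro n
      have h1 : z (n + 1) - z n = α (n + 1) • (T (z (n + 1)) - T (z n))
          + (α (n + 1) - α n) • (T (z n) - a0) := by
        conv_lhs => rw [hzf (n + 1), hzf n]
        module
      have h2 : ‖z (n + 1) - z n‖ ≤ α (n + 1) * ‖z (n + 1) - z n‖ + |α (n + 1) - α n| * C := by
        calc _ ≤ ‖α (n + 1) • (T (z (n + 1)) - T (z n))‖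
              + ‖(α (n + 1) - α n) • (T (z n) - a0)‖ := by
                conv_lhs => rw [h1]
                exact norm_add_le _ _
          _ ≤ _ := by
            rw [norm_smul, norm_smul, Real.norm_of_nonneg (hα (n + 1)).1, Real.norm_eq_abs]
            have := (hα (n + 1)).1
            gcongr
            · exact hT _ _
            · exact hC n
      linarith
    have hs : Tendsto (fun n => ‖a (n + 1) - z n‖) atTop (𝓝 0) := by
      refine aux_xu _ (fun n => 1 - α (n + 1))
        (fun n => C * |(α (n + 1) - α n) / (1 - α (n + 1)) ^ 2|)
        (fun n => norm_nonneg _) (fun n => by linarith [(hα (n + 1)).2])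
        (fun n => by linarith [(hα (n + 1)).1]) ?_ ?_ ?_
      · have h1 := (tendsto_add_atTop_iff_nat 1).2 hαsum
        have h2 := tendsto_atTop_add_const_right _ (-(1 - α 0)) h1
        refine h2.congr fun n => ?_
        rw [Finset.sum_range_succ']; ring
      · simpa using hαreg.abs.const_mul C
      · intro n
        have hp : 0 < 1 - α (n + 1) := by linarith [(hα (n + 1)).2]
        have h1 : ‖a (n + 1 + 1) - z (n + 1)‖ ≤ α (n + 1) * ‖a (n + 1) - z (n + 1)‖ := by
          conv_lhs => rw [ha (n + 1), hzf (n + 1), add_sub_add_left_eq_sub, ← smul_sub, norm_smul,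
            Real.norm_of_nonneg (hα (n + 1)).1]
          exact mul_le_mul_of_nonneg_left (hT _ _) (hα (n + 1)).1
        have h2 : ‖a (n + 1) - z (n + 1)‖ ≤ ‖a (n + 1) - z n‖ + ‖z (n + 1) - z n‖ := by
          rw [norm_sub_rev (z (n + 1))]
          exact norm_sub_le_norm_sub_add_norm_sub _ _ _
        have h3 : ‖z (n + 1) - z n‖ ≤
            (1 - α (n + 1)) * (C * |(α (n + 1) - α n) / (1 - α (n + 1)) ^ 2|) := by
          have h4 : (1 - α (n + 1)) * (C * |(α (n + 1) - α n) / (1 - α (n + 1)) ^ 2|)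
              = |α (n + 1) - α n| * C / (1 - α (n + 1)) := by
            rw [abs_div, abs_of_nonneg (sq_nonneg (1 - α (n + 1)))]
            field_simp
          rw [h4, le_div_iff₀ hp, mul_comm]
          exact hstep n
        have h5 := (hα (n + 1)).1
        have h6 : α (n + 1) * ‖z (n + 1) - z n‖ ≤ ‖z (n + 1) - z n‖ :=
          mul_le_of_le_one_left (norm_nonneg _) (by linarith)
        have h7 := mul_le_mul_of_nonneg_left h2 h5
        simp only [sub_sub_cancel]
        linarith
    have h0 := (tendsto_zero_iff_norm_tendsto_zero.2 hs).add hg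
    rw [← tendsto_add_atTop_iff_nat 1]
    simpa using h0

lemma aux_var {P : E → E} {C : Set E} (hC : Convex ℝ C) (hP : IsProjOn P C) (x y : E)
    (hy : y ∈ C) : ⟪x - P x, y - P x⟫ ≤ 0 := by
  refine (norm_eq_iInf_iff_real_inner_le_zero hC (hP x).1).1 ?_ y hy
  have : Nonempty C := ⟨⟨P x, (hP x).1⟩⟩
  refine le_antisymm (le_ciInf fun c => (hP x).2 c c.2) ?_
  exact ciInf_le ⟨0, by rintro _ ⟨c, rfl⟩; exact norm_nonneg _⟩ (⟨P x, (hP x).1⟩ : C)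

lemma aux_infDist {P : E → E} {C : Set E} (hP : IsProjOn P C) (x : E) :
    Metric.infDist x C = ‖x - P x‖ := by
  refine le_antisymm ?_ ?_
  · rw [← dist_eq_norm]; exact Metric.infDist_le_dist_of_mem (hP x).1
  · rw [Metric.le_infDist ⟨P x, (hP x).1⟩]
    intro y hy
    rw [dist_eq_norm]; exact (hP x).2 y hy

lemma aux_nonexp {P : E → E} {C : Set E} (hC : Convex ℝ C) (hP : IsProjOn P C)
    (lam : ℝ) (h0 : 0 < lam) (h2 : lam ≤ 2) (x y : E) :
    ‖((1 - lam) • x + lam • P x) - ((1 - lam) • y + lam • P y)‖ ≤ ‖x - y‖ := by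
  have h3 := aux_var hC hP x (P y) (hP y).1
  have h4 := aux_var hC hP y (P x) (hP x).1
  set f := (P x - P y) - (x - y) with hf
  set d := x - y with hd
  have h5 : ((1 - lam) • x + lam • P x) - ((1 - lam) • y + lam • P y) = d + lam • f := by
    simp only [hf, hd]; module
  have h6 : ‖f‖ ^ 2 + ⟪d, f⟫ ≤ 0 := by
    have e1 : ‖f‖ ^ 2 + ⟪d, f⟫ = ⟪f, P x - P y⟫ := by
      rw [← real_inner_self_eq_norm_sq, ← inner_add_left, real_inner_comm]
      congr 1; simp only [hf]; abel
    have e2 : ⟪f, P x - P y⟫ = ⟪x - P x, P y - P x⟫ + ⟪y - P y, P x - P y⟫ := by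
      have : P y - P x = -(P x - P y) := by abel
      rw [this, inner_neg_right, ← inner_neg_left, ← inner_add_left]
      congr 1; simp only [hf, hd]; abel
    linarith
  rw [h5]
  refine le_of_sq_le_sq ?_ (norm_nonneg _)
  rw [norm_add_sq_real, real_inner_smul_right, norm_smul, Real.norm_of_nonneg h0.le, mul_pow]
  nlinarith [mul_le_mul_of_nonneg_left h6 h0.le,
    mul_nonneg (mul_nonneg h0.le (sub_nonneg.2 h2)) (sq_nonneg ‖f‖)]

end

/-- Combettes: the anchored (Halpern-type) relaxed parallel projection method converges
strongly to the projection of the starting point `a₀` onto the set `G` of minimizers of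
the proximity function `Φ`, provided one of the sets is bounded. -/
theorem stmt7 {Ξ : Type*} [NormedAddCommGroup Ξ] [InnerProductSpace ℝ Ξ] [CompleteSpace Ξ]
    {m : ℕ} (S : Fin m → Set Ξ)
    (hne : ∀ i, (S i).Nonempty) (hcl : ∀ i, IsClosed (S i)) (hcv : ∀ i, Convex ℝ (S i))
    (hbdd : ∃ i, Bornology.IsBounded (S i))
    (w : Fin m → ℝ) (hw : ∀ i, 0 < w i) (hw1 : ∑ i, w i = 1)
    (P : Fin m → Ξ → Ξ) (hP : ∀ i, IsProjOn (P i) (S i))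
    (lam : ℝ) (hlam0 : 0 < lam) (hlam2 : lam ≤ 2)
    (α : ℕ → ℝ) (hα : ∀ n, α n ∈ Set.Ico (0 : ℝ) 1)
    (hα1 : Tendsto α atTop (nhds 1))
    (hαsum : Tendsto (fun N : ℕ => ∑ n ∈ Finset.range N, (1 - α n)) atTop atTop)
    (hαreg : Tendsto (fun n : ℕ => (α (n + 1) - α n) / (1 - α (n + 1)) ^ 2) atTop (nhds 0))
    (a0 : Ξ) (a : ℕ → Ξ) (ha0 : a 0 = a0)
    (ha : ∀ n : ℕ, a (n + 1) =
      (1 - α n) • a0 + α n • ((1 - lam) • a n + lam • ∑ i, w i • P i (a n))) :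
    ∃ g : Ξ, (∀ u : Ξ, prox w S g ≤ prox w S u) ∧
      (∀ u : Ξ, (∀ v : Ξ, prox w S u ≤ prox w S v) → ‖a0 - g‖ ≤ ‖a0 - u‖) ∧
      Tendsto a atTop (nhds g) := by
  set T : Ξ → Ξ := fun x => (1 - lam) • x + lam • ∑ i, w i • P i x with hTdef
  have hTsum : ∀ x, T x = ∑ i, w i • ((1 - lam) • x + lam • P i x) := by
    intro x
    simp only [hTdef, smul_add, Finset.sum_add_distrib]
    rw [← Finset.sum_smul, hw1, one_smul, Finset.smul_sum]
    congr 1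
    exact Finset.sum_congr rfl fun i _ => smul_comm _ _ _
  have hT : ∀ x y, ‖T x - T y‖ ≤ ‖x - y‖ := by
    intro x y
    rw [hTsum, hTsum, ← Finset.sum_sub_distrib]
    calc _ ≤ ∑ i, w i * ‖x - y‖ := by
          refine norm_sum_le_of_le _ fun i _ => ?_
          rw [← smul_sub, norm_smul, Real.norm_of_nonneg (hw i).le]
          exact mul_le_mul_of_nonneg_left (aux_nonexp (hcv i) (hP i) lam hlam0 hlam2 x y) (hw i).le
      _ = _ := by rw [← Finset.sum_mul, hw1, one_mul]
  have hA : ∀ x, x - T x = lam • ∑ i, w i • (x - P i x) := by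
    intro x
    simp only [smul_sub, Finset.sum_sub_distrib]
    rw [← Finset.sum_smul, hw1, one_smul]
    simp only [hTdef]; module
  have hQ : ∀ x, ∑ i, w i • (x - P i x) = x - ∑ i, w i • P i x := by
    intro x
    simp only [smul_sub, Finset.sum_sub_distrib]
    rw [← Finset.sum_smul, hw1, one_smul]
  have hprox : ∀ x, prox w S x = (1 / 2) * ∑ i, w i * ‖x - P i x‖ ^ 2 := by
    intro x
    simp only [prox]
    congr 1
    exact Finset.sum_congr rfl fun i _ => by rw [aux_infDist (hP i)]
  -- boundedness of the path
  have hBex : ∃ B : ℝ, ∀ t : ℝ, 0 ≤ t → t < 1 → ∀ x, (1 - t) • (a0 - x) = t • (x - T x) →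
      ‖a0 - x‖ ≤ B := by
    obtain ⟨j, hj⟩ := hbdd
    obtain ⟨c, hc⟩ := hne j
    obtain ⟨R, hR⟩ := hj.subset_closedBall c
    set D : ℝ := ∑ i, w i * ‖c - P i c‖ ^ 2 with hD
    have hD0 : 0 ≤ D := Finset.sum_nonneg fun i _ => mul_nonneg (hw i).le (sq_nonneg _)
    refine ⟨2 * ‖a0 - c‖ + (|R| + (D / w j + 1)), fun t ht0 ht1 x hx => ?_⟩
    have hfin : ‖x - c‖ ≤ ‖a0 - c‖ + (|R| + (D / w j + 1)) := by
      by_contra hcon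
      push Not at hcon
      have hDw : 0 ≤ D / w j := div_nonneg hD0 (hw j).le
      have hterm : ∀ i, w i * (‖x - P i x‖ ^ 2 / 2 - ‖c - P i c‖ ^ 2 / 2)
          ≤ ⟪w i • (x - P i x), x - c⟫ := by
        intro i
        rw [real_inner_smul_left]
        refine mul_le_mul_of_nonneg_left ?_ (hw i).le
        have h1 := aux_var (hcv i) (hP i) x (P i c) (hP i c).1
        have h2 : x - c = (x - P i x) - (P i c - P i x) - (c - P i c) := by abel
        rw [h2, inner_sub_right, inner_sub_right, real_inner_self_eq_norm_sq]
        have h3 := real_inner_le_norm (x - P i x) (c - P i c)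
        nlinarith [sq_nonneg (‖x - P i x‖ - ‖c - P i c‖)]
      have h1 : w j * ‖x - P j x‖ ^ 2 / 2 - D / 2 ≤ ⟪∑ i, w i • (x - P i x), x - c⟫ := by
        rw [sum_inner]
        refine le_trans ?_ (Finset.sum_le_sum fun i _ => hterm i)
        have h2 : ∑ i, w i * (‖x - P i x‖ ^ 2 / 2 - ‖c - P i c‖ ^ 2 / 2)
            = (∑ i, w i * ‖x - P i x‖ ^ 2) / 2 - D / 2 := by
          rw [hD, Finset.sum_div, Finset.sum_div, ← Finset.sum_sub_distrib]
          exact Finset.sum_congr rfl fun i _ => by ring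
        rw [h2]
        have h3 := Finset.single_le_sum (f := fun i => w i * ‖x - P i x‖ ^ 2)
          (fun i _ => mul_nonneg (hw i).le (sq_nonneg _)) (Finset.mem_univ j)
        linarith
      have h2 : ⟪a0 - x, x - c⟫ < 0 := by
        have e : a0 - x = (a0 - c) - (x - c) := by abel
        rw [e, inner_sub_left, real_inner_self_eq_norm_sq]
        have := real_inner_le_norm (a0 - c) (x - c)
        nlinarith [abs_nonneg R, norm_nonneg (a0 - c), norm_nonneg (x - c)]
      have h3 : t * (lam * ⟪∑ i, w i • (x - P i x), x - c⟫) < 0 := by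
        rw [← real_inner_smul_left, ← hA, ← real_inner_smul_left, ← hx, real_inner_smul_left]
        exact mul_neg_of_pos_of_neg (by linarith) h2
      have h4 : ⟪∑ i, w i • (x - P i x), x - c⟫ < 0 := by
        by_contra h
        push Not at h
        have := mul_nonneg ht0 (mul_nonneg hlam0.le h)
        linarith
      have h5 : w j * ‖x - P j x‖ ^ 2 < D := by linarith
      have h6 : ‖x - P j x‖ ^ 2 < D / w j := by rw [lt_div_iff₀ (hw j)]; linarith
      have h7 : ‖P j x - c‖ ≤ R := by
        have := hR (hP j x).1
        rwa [Metric.mem_closedBall, dist_eq_norm] at this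
      have h8 := norm_sub_le_norm_sub_add_norm_sub x (P j x) c
      nlinarith [le_abs_self R, norm_nonneg (a0 - c), sq_nonneg (‖x - P j x‖ - 1)]
    have := norm_sub_le_norm_sub_add_norm_sub a0 c x
    rw [norm_sub_rev c x] at this
    linarith
  obtain ⟨B, hB⟩ := hBex
  obtain ⟨g, hg1, hg2, hg3⟩ := aux_halpern T hT a0 B hB α hα hα1 hαsum hαreg a ha
  refine ⟨g, ?_, ?_, hg3⟩
  · intro u
    have h0 : ∑ i, w i • (g - P i g) = 0 := by
      have := hA g
      rw [hg1, sub_self] at this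
      exact (smul_eq_zero.1 this.symm).resolve_left hlam0.ne'
    rw [hprox, hprox]
    have h1 : ∀ i, w i * ‖g - P i g‖ ^ 2 + 2 * ⟪w i • (g - P i g), u - g⟫
        ≤ w i * ‖u - P i u‖ ^ 2 := by
      intro i
      rw [real_inner_smul_left]
      have h2 := aux_var (hcv i) (hP i) g (P i u) (hP i u).1
      have h3 : u - P i u = (g - P i g) + ((u - g) - (P i u - P i g)) := by abel
      have h4 : ‖g - P i g‖ ^ 2 + 2 * ⟪g - P i g, u - g⟫ ≤ ‖u - P i u‖ ^ 2 := by
        rw [h3, norm_add_sq_real, inner_sub_right (g - P i g) (u - g) (P i u - P i g)]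
        nlinarith [sq_nonneg ‖(u - g) - (P i u - P i g)‖]
      nlinarith [mul_le_mul_of_nonneg_left h4 (hw i).le]
    have h2 := Finset.sum_le_sum fun i (_ : i ∈ Finset.univ) => h1 i
    rw [Finset.sum_add_distrib, ← Finset.mul_sum, ← sum_inner, h0, inner_zero_left] at h2
    linarith
  · intro u hu
    apply hg2
    set q := ∑ i, w i • P i u with hq
    have h1 := hu q
    rw [hprox, hprox] at h1
    have h2 : ∀ i, w i * ‖q - P i q‖ ^ 2 ≤
        w i * ‖u - P i u‖ ^ 2 - 2 * ⟪w i • (u - P i u), u - q⟫ + w i * ‖u - q‖ ^ 2 := by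
      intro i
      have h3 := (hP i q).2 (P i u) (hP i u).1
      have h4 : ‖q - P i q‖ ^ 2 ≤ ‖q - P i u‖ ^ 2 := pow_le_pow_left₀ (norm_nonneg _) h3 2
      have h5 : q - P i u = (u - P i u) - (u - q) := by abel
      rw [h5, norm_sub_sq_real (u - P i u) (u - q)] at h4
      rw [real_inner_smul_left]
      nlinarith [mul_le_mul_of_nonneg_left h4 (hw i).le]
    have h3 := Finset.sum_le_sum fun i (_ : i ∈ Finset.univ) => h2 i
    rw [Finset.sum_add_distrib, Finset.sum_sub_distrib, ← Finset.mul_sum, ← sum_inner, hQ,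
      ← Finset.sum_mul, hw1, ← hq, real_inner_self_eq_norm_sq] at h3
    have h4 : ‖u - q‖ ^ 2 ≤ 0 := by linarith
    have h5 : u - q = 0 := by
      rw [← norm_eq_zero]; exact pow_eq_zero_iff (two_ne_zero) |>.1 (le_antisymm h4 (sq_nonneg _))
    have h6 := hA u
    rw [hQ, ← hq, h5, smul_zero] at h6
    exact (sub_eq_zero.1 h6).symm
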